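/- There exists a constant c > 0 such that for every integer q ≥ 3, every finite set of at least c·q²·log q points in the plane ℝ² contains either q collinear points or q points in general position. (In the paper's notation: GP(q) ≤ O(q² ln q), where GP(q) is the minimum integer such that every set of at least GP(q) points in the plane contains q collinear points or q points in general position.) -/

import Mathlib

/-- A finite point set is in general position if no three of its points are collinear. -/
def GeneralPosition (S : Finset (ℝ × ℝ)) : Prop :=
  ∀ T ⊆ S, Collinear ℝ (T : Set (ℝ × ℝ)) → T.card ≤ 2

/-- The height at abscissa `x` of the non-vertical line with slope `l.1` and intercept `l.2`. -/
def lineHeight (l : ℝ × ℝ) (x : ℝ) : ℝ := l.1 * x + l.2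

/-- Slope and intercept of the line through two points with distinct abscissas. -/
noncomputable def lineThrough (e : (ℝ × ℝ) × (ℝ × ℝ)) : ℝ × ℝ :=
  ((e.2.2 - e.1.2) / (e.2.1 - e.1.1), e.1.2 - (e.2.2 - e.1.2) / (e.2.1 - e.1.1) * e.1.1)

lemma lineHeight_lineThrough_fst (e : (ℝ × ℝ) × (ℝ × ℝ)) :
    lineHeight (lineThrough e) e.1.1 = e.1.2 := by
  simp only [lineHeight, lineThrough]; ring

lemma lineHeight_lineThrough_snd {e : (ℝ × ℝ) × (ℝ × ℝ)} (h : e.1.1 < e.2.1) :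
    lineHeight (lineThrough e) e.2.1 = e.2.2 := by
  have : e.2.1 - e.1.1 ≠ 0 := by linarith
  simp only [lineHeight, lineThrough]; field_simp; ring

lemma line_eq_of_lineHeight_eq {l m : ℝ × ℝ} {x y : ℝ} (hxy : x ≠ y)
    (hx : lineHeight l x = lineHeight m x) (hy : lineHeight l y = lineHeight m y) : l = m := by
  simp only [lineHeight] at hx hy
  have h : (l.1 - m.1) * (x - y) = 0 := by linarith
  have h1 : l.1 = m.1 := by
    rcases mul_eq_zero.1 h with h | h
    · linarith
    · exact absurd (sub_eq_zero.1 h) hxy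
  refine Prod.ext h1 ?_
  rw [h1] at hx; linarith

lemma exists_lineHeight_eq {l m : ℝ × ℝ} {s t x y : ℝ} (hx : x ∈ Set.Ioo s t)
    (hy : y ∈ Set.Icc s t) (hlx : lineHeight l x < lineHeight m x)
    (hly : lineHeight m y < lineHeight l y) :
    ∃ z ∈ Set.Ioo s t, lineHeight l z = lineHeight m z := by
  have hpos : 0 < (lineHeight m x - lineHeight l x) + (lineHeight l y - lineHeight m y) := by
    linarith
  set D := (lineHeight m x - lineHeight l x) + (lineHeight l y - lineHeight m y) with hD
  refine ⟨((lineHeight m x - lineHeight l x) * y + (lineHeight l y - lineHeight m y) * x) / D,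
    ⟨?_, ?_⟩, ?_⟩
  · rw [lt_div_iff₀ hpos, hD]
    nlinarith [hx.1, hy.1, mul_pos (sub_pos.2 hly) (sub_pos.2 hx.1),
      mul_nonneg (sub_pos.2 hlx).le (sub_nonneg.2 hy.1)]
  · rw [div_lt_iff₀ hpos, hD]
    nlinarith [hx.1, hy.1, mul_pos (sub_pos.2 hly) (sub_pos.2 hx.2),
      mul_nonneg (sub_pos.2 hlx).le (sub_nonneg.2 hy.2)]
  · have hne := hpos.ne'
    simp only [lineHeight] at hD ⊢
    field_simp
    rw [hD]; ring

/-- A crossing-free straight-line drawing of a graph whose vertices have distinct abscissas; edges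
are directed from left to right. -/
structure IsPlaneDrawing (V : Finset (ℝ × ℝ)) (E : Finset ((ℝ × ℝ) × (ℝ × ℝ))) : Prop where
  injOn : Set.InjOn Prod.fst (V : Set (ℝ × ℝ))
  fst_mem : ∀ e ∈ E, e.1 ∈ V
  snd_mem : ∀ e ∈ E, e.2 ∈ V
  lt : ∀ e ∈ E, e.1.1 < e.2.1
  avoid : ∀ e ∈ E, ∀ z ∈ V, e.1.1 < z.1 → z.1 < e.2.1 → z.2 ≠ lineHeight (lineThrough e) z.1
  eq_of_meet : ∀ e ∈ E, ∀ f ∈ E, ∀ x, e.1.1 < x → x < e.2.1 → f.1.1 < x → x < f.2.1 →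
    lineHeight (lineThrough e) x = lineHeight (lineThrough f) x → e = f

namespace IsPlaneDrawing

variable {V : Finset (ℝ × ℝ)} {E : Finset ((ℝ × ℝ) × (ℝ × ℝ))}

lemma height_le (h : IsPlaneDrawing V E) {e f : (ℝ × ℝ) × (ℝ × ℝ)} (he : e ∈ E) (hf : f ∈ E)
    {s t x y : ℝ} (hes : e.1.1 ≤ s) (het : t ≤ e.2.1) (hfs : f.1.1 ≤ s) (hft : t ≤ f.2.1)
    (hx : x ∈ Set.Ioo s t) (hy : y ∈ Set.Icc s t)
    (hlt : lineHeight (lineThrough e) x < lineHeight (lineThrough f) x) :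
    lineHeight (lineThrough e) y ≤ lineHeight (lineThrough f) y := by
  by_contra! hc
  obtain ⟨z, hz, hzeq⟩ := exists_lineHeight_eq hx hy hlt hc
  have := h.eq_of_meet e he f hf z (hes.trans_lt hz.1) (hz.2.trans_le het) (hfs.trans_lt hz.1)
    (hz.2.trans_le hft) hzeq
  rw [this] at hlt
  exact lt_irrefl _ hlt

lemma eq_of_slope_eq (h : IsPlaneDrawing V E) {e f : (ℝ × ℝ) × (ℝ × ℝ)} (he : e ∈ E) (hf : f ∈ E)
    (hef : e.1 = f.1) (hs : (lineThrough e).1 = (lineThrough f).1) : e = f := by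
  have hl : lineThrough e = lineThrough f := by
    refine Prod.ext hs ?_
    have h1 := lineHeight_lineThrough_fst e
    have h2 := lineHeight_lineThrough_fst f
    rw [← hef, ← h1] at h2
    simp only [lineHeight, hs] at h2
    linarith
  obtain ⟨x, hx1, hx2⟩ := exists_between (lt_min (h.lt e he) (hef ▸ h.lt f hf))
  rw [lt_min_iff] at hx2
  exact h.eq_of_meet e he f hf x hx1 hx2.1 (hef ▸ hx1) hx2.2 (by rw [hl])

lemma eq_snd_of_mem (h : IsPlaneDrawing V E) {e : (ℝ × ℝ) × (ℝ × ℝ)} (he : e ∈ E) {z : ℝ × ℝ}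
    (hz : z ∈ V) (h1 : e.1.1 < z.1) (h2 : z.1 ≤ e.2.1)
    (h3 : z.2 = lineHeight (lineThrough e) z.1) : z = e.2 := by
  rcases h2.lt_or_eq with h2 | h2
  · exact absurd h3 (h.avoid e he z hz h1 h2)
  · exact h.injOn hz (h.snd_mem e he) h2

end IsPlaneDrawing

/-- `f` is the edge following `e` in the counterclockwise order around their common left endpoint,
and `z` is the leftmost vertex in the wedge between them. -/
structure IsWedge (V : Finset (ℝ × ℝ)) (E : Finset ((ℝ × ℝ) × (ℝ × ℝ)))
    (e f : (ℝ × ℝ) × (ℝ × ℝ)) (z : ℝ × ℝ) : Prop where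
  mem_left : e ∈ E
  mem_right : f ∈ E
  fst_eq : f.1 = e.1
  slope_lt : (lineThrough e).1 < (lineThrough f).1
  slope_min : ∀ g ∈ E, g.1 = e.1 → (lineThrough e).1 < (lineThrough g).1 →
    (lineThrough f).1 ≤ (lineThrough g).1
  mem : z ∈ V
  lt : e.1.1 < z.1
  le_left : z.1 ≤ e.2.1
  le_right : z.1 ≤ f.2.1
  le_height : lineHeight (lineThrough e) z.1 ≤ z.2
  height_le : z.2 ≤ lineHeight (lineThrough f) z.1
  leftmost : ∀ w ∈ V, e.1.1 < w.1 → lineHeight (lineThrough e) w.1 ≤ w.2 →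
    w.2 ≤ lineHeight (lineThrough f) w.1 → z.1 ≤ w.1

lemma lineHeight_sub_of_fst_eq {e f : (ℝ × ℝ) × (ℝ × ℝ)} (hef : f.1 = e.1) (x : ℝ) :
    lineHeight (lineThrough f) x - lineHeight (lineThrough e) x =
      ((lineThrough f).1 - (lineThrough e).1) * (x - e.1.1) := by
  have h1 := lineHeight_lineThrough_fst e
  have h2 := lineHeight_lineThrough_fst f
  rw [hef, ← h1] at h2
  simp only [lineHeight] at h2 ⊢
  linarith

namespace IsPlaneDrawing

variable {V : Finset (ℝ × ℝ)} {E : Finset ((ℝ × ℝ) × (ℝ × ℝ))}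

lemma exists_isWedge (h : IsPlaneDrawing V E) {e g : (ℝ × ℝ) × (ℝ × ℝ)} (he : e ∈ E) (hg : g ∈ E)
    (hge : g.1 = e.1) (hs : (lineThrough e).1 < (lineThrough g).1) :
    ∃ f z, IsWedge V E e f z := by
  classical
  obtain ⟨f, hf, hmin⟩ := Finset.exists_min_image
    (E.filter fun g => g.1 = e.1 ∧ (lineThrough e).1 < (lineThrough g).1)
    (fun g => (lineThrough g).1) ⟨g, by simp [hg, hge, hs]⟩
  simp only [Finset.mem_filter] at hf hmin
  obtain ⟨hfE, hfe, hsf⟩ := hf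
  have hsub := lineHeight_sub_of_fst_eq hfe
  have hle : ∀ x, e.1.1 ≤ x → lineHeight (lineThrough e) x ≤ lineHeight (lineThrough f) x := by
    intro x hx
    have := mul_nonneg (sub_pos.2 hsf).le (sub_nonneg.2 hx)
    linarith [hsub x]
  let W := V.filter fun w => e.1.1 < w.1 ∧ lineHeight (lineThrough e) w.1 ≤ w.2 ∧
    w.2 ≤ lineHeight (lineThrough f) w.1
  have hlt1 := h.lt e he
  have hlt2 : e.1.1 < f.2.1 := hfe ▸ h.lt f hfE
  have heW : e.2 ∈ W := by
    simp only [W, Finset.mem_filter]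
    refine ⟨h.snd_mem e he, hlt1, (lineHeight_lineThrough_snd hlt1).le, ?_⟩
    rw [← lineHeight_lineThrough_snd hlt1]
    exact hle _ hlt1.le
  have hfW : f.2 ∈ W := by
    simp only [W, Finset.mem_filter]
    refine ⟨h.snd_mem f hfE, hlt2, ?_, (lineHeight_lineThrough_snd (h.lt f hfE)).ge⟩
    rw [← lineHeight_lineThrough_snd (h.lt f hfE)]
    exact hle _ hlt2.le
  obtain ⟨z, hz, hzmin⟩ := Finset.exists_min_image W Prod.fst ⟨_, heW⟩
  have hz' := hz
  simp only [W, Finset.mem_filter] at hz'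
  exact ⟨f, z, he, hfE, hfe, hsf, fun g hg h1 h2 => hmin g ⟨hg, h1, h2⟩, hz'.1, hz'.2.1,
    hzmin _ heW, hzmin _ hfW, hz'.2.2.1, hz'.2.2.2, fun w hw h1 h2 h3 =>
      hzmin w (by simp only [W, Finset.mem_filter]; exact ⟨hw, h1, h2, h3⟩)⟩

/-- No edge runs strictly inside a wedge to the left of its leftmost vertex. -/
lemma not_between (h : IsPlaneDrawing V E) {e f g : (ℝ × ℝ) × (ℝ × ℝ)} {z : ℝ × ℝ}
    (hw : IsWedge V E e f z) (hg : g ∈ E) {x : ℝ} (hx : e.1.1 < x) (hxz : x < z.1)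
    (hgx : g.1.1 < x) (hxg : x < g.2.1)
    (h1 : lineHeight (lineThrough e) x < lineHeight (lineThrough g) x)
    (h2 : lineHeight (lineThrough g) x < lineHeight (lineThrough f) x) : False := by
  have hfe : f.1.1 = e.1.1 := by rw [hw.fst_eq]
  have key : ∀ s, e.1.1 ≤ s → g.1.1 ≤ s → s < x →
      lineHeight (lineThrough e) s ≤ lineHeight (lineThrough g) s ∧
      lineHeight (lineThrough g) s ≤ lineHeight (lineThrough f) s := by
    intro s hs1 hs2 hs
    obtain ⟨t, ht1, ht2⟩ := exists_between (lt_min hxz hxg)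
    rw [lt_min_iff] at ht2
    have hxI : x ∈ Set.Ioo s t := ⟨hs, ht1⟩
    have hsI : s ∈ Set.Icc s t := ⟨le_rfl, (hs.trans ht1).le⟩
    exact ⟨h.height_le hw.mem_left hg hs1 (ht2.1.le.trans hw.le_left) hs2 ht2.2.le hxI hsI h1,
      h.height_le hg hw.mem_right hs2 ht2.2.le (hfe ▸ hs1) (ht2.1.le.trans hw.le_right) hxI hsI h2⟩
  rcases lt_trichotomy g.1.1 e.1.1 with hlt | heq | hgt
  · obtain ⟨k1, k2⟩ := key _ le_rfl hlt.le hx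
    rw [lineHeight_lineThrough_fst] at k1
    rw [← hfe, lineHeight_lineThrough_fst, hfe, hw.fst_eq] at k2
    exact h.avoid g hg _ (h.fst_mem e hw.mem_left) hlt (hx.trans hxg) (le_antisymm k1 k2)
  · have hge : g.1 = e.1 := h.injOn (h.fst_mem g hg) (h.fst_mem e hw.mem_left) heq
    have e1 := lineHeight_sub_of_fst_eq hge x
    have e2 := lineHeight_sub_of_fst_eq (hge.trans hw.fst_eq.symm) x
    have hpos : 0 < x - e.1.1 := sub_pos.2 hx
    rw [hfe] at e2
    have s1 : (lineThrough e).1 < (lineThrough g).1 := by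
      by_contra! hc
      have := mul_nonneg (sub_nonneg.2 hc) hpos.le
      linarith
    have s2 := mul_nonneg (sub_nonneg.2 (hw.slope_min g hg hge s1)) hpos.le
    linarith
  · obtain ⟨k1, k2⟩ := key _ hgt.le le_rfl hgx
    rw [lineHeight_lineThrough_fst] at k1 k2
    have := hw.leftmost g.1 (h.fst_mem g hg) hgt k1 k2
    linarith

/-- Of two wedges with the same leftmost vertex, the lower one has it on its upper edge and the
upper one on its lower edge. -/
lemma eq_snd_of_lt (h : IsPlaneDrawing V E) {e f e' f' : (ℝ × ℝ) × (ℝ × ℝ)} {z : ℝ × ℝ}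
    (hw : IsWedge V E e f z) (hw' : IsWedge V E e' f' z) {x : ℝ} (hx : e.1.1 < x)
    (hx' : e'.1.1 < x) (hxz : x < z.1)
    (hlt : lineHeight (lineThrough e) x < lineHeight (lineThrough e') x) :
    z = f.2 ∧ z = e'.2 := by
  have hfe : f.1.1 = e.1.1 := by rw [hw.fst_eq]
  have h1 : lineHeight (lineThrough f) x ≤ lineHeight (lineThrough e') x := by
    by_contra! hc
    exact h.not_between hw hw'.mem_left hx hxz hx' (hxz.trans_le hw'.le_left) hlt hc
  have h2 : lineHeight (lineThrough f) z.1 ≤ lineHeight (lineThrough e') z.1 := by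
    rcases h1.lt_or_eq with h1 | h1
    · refine h.height_le hw.mem_right hw'.mem_left (s := max e.1.1 e'.1.1) (t := z.1) (x := x)
        (by rw [hfe]; exact le_max_left _ _) hw.le_right (le_max_right _ _) hw'.le_left
        ⟨max_lt hx hx', hxz⟩ ⟨(max_lt hx hx').le.trans hxz.le, le_rfl⟩ h1
    · rw [h.eq_of_meet f hw.mem_right e' hw'.mem_left x (hfe ▸ hx) (hxz.trans_le hw.le_right) hx'
        (hxz.trans_le hw'.le_left) h1]
  exact ⟨h.eq_snd_of_mem hw.mem_right hw.mem (hfe ▸ hw.lt) hw.le_right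
      (le_antisymm hw.height_le (h2.trans hw'.le_height)),
    h.eq_snd_of_mem hw'.mem_left hw.mem hw'.lt hw'.le_left
      (le_antisymm (hw.height_le.trans h2) hw'.le_height)⟩

/-- A weak form of Euler's bound on the number of edges of a plane graph. -/
theorem card_le (h : IsPlaneDrawing V E) : E.card ≤ 3 * V.card := by
  classical
  let B := E.filter fun e => ∃ g ∈ E, g.1 = e.1 ∧ (lineThrough e).1 < (lineThrough g).1
  have hB : ∀ e ∈ B, ∃ p : ((ℝ × ℝ) × (ℝ × ℝ)) × (ℝ × ℝ), IsWedge V E e p.1 p.2 := by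
    intro e he
    obtain ⟨he, g, hg, hge, hs⟩ := Finset.mem_filter.1 he
    obtain ⟨f, z, hfz⟩ := h.exists_isWedge he hg hge hs
    exact ⟨(f, z), hfz⟩
  choose! p hp using hB
  have hne : ∀ e ∈ B, e.2 ≠ (p e).1.2 := fun e he heq => by
    have hlt := (hp e he).slope_lt
    rw [show (p e).1 = e from Prod.ext (hp e he).fst_eq heq.symm] at hlt
    exact lt_irrefl _ hlt
  have hcardB : B.card ≤ (V ×ˢ (Finset.univ : Finset Bool)).card := by
    refine Finset.card_le_card_of_injOn (fun e => ((p e).2, decide ((p e).2 = e.2)))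
      (fun e he => by simpa [em] using (hp e he).mem) ?_
    intro e he e' he' heq
    simp only [Prod.mk.injEq, decide_eq_decide] at heq
    obtain ⟨hz, hiff⟩ := heq
    by_contra hee
    have hw := hp e he
    have hw' := hp e' he'
    rw [← hz] at hw' hiff
    obtain ⟨x, hx1, hx2⟩ := exists_between (max_lt hw.lt hw'.lt)
    rw [max_lt_iff] at hx1
    rcases lt_trichotomy (lineHeight (lineThrough e) x) (lineHeight (lineThrough e') x)
      with hlt | heq | hgt
    · obtain ⟨k1, k2⟩ := h.eq_snd_of_lt hw hw' hx1.1 hx1.2 hx2 hlt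
      exact hne e he ((hiff.2 k2).symm.trans k1)
    · exact hee (h.eq_of_meet e hw.mem_left e' hw'.mem_left x hx1.1 (hx2.trans_le hw.le_left)
        hx1.2 (hx2.trans_le hw'.le_left) heq)
    · obtain ⟨k1, k2⟩ := h.eq_snd_of_lt hw' hw hx1.2 hx1.1 hx2 hgt
      exact hne e' he' ((hiff.1 k2).symm.trans k1)
  have hcardT : (E \ B).card ≤ V.card := by
    refine Finset.card_le_card_of_injOn Prod.fst
      (fun e he => h.fst_mem e (Finset.mem_sdiff.1 he).1) ?_
    intro e he e' he' heq
    have h1 := Finset.mem_sdiff.1 he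
    have h2 := Finset.mem_sdiff.1 he'
    refine h.eq_of_slope_eq h1.1 h2.1 heq (le_antisymm ?_ ?_)
    · by_contra! hc
      exact h2.2 (Finset.mem_filter.2 ⟨h2.1, e, h1.1, heq, hc⟩)
    · by_contra! hc
      exact h1.2 (Finset.mem_filter.2 ⟨h1.1, e', h2.1, heq.symm, hc⟩)
  have hsplit : (E \ B).card + B.card = E.card :=
    Finset.card_sdiff_add_card_eq_card (Finset.filter_subset _ _)
  rw [Finset.card_product] at hcardB
  simp only [Finset.card_univ, Fintype.card_bool] at hcardB
  omega

end IsPlaneDrawing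

/-- The edges of the drawing formed by the segments between consecutive points of `P` on lines
of `L`. -/
noncomputable def arrangementEdges (P L : Finset (ℝ × ℝ)) : Finset ((ℝ × ℝ) × (ℝ × ℝ)) := by
  classical
  exact (P ×ˢ P).filter fun e => e.1.1 < e.2.1 ∧ lineThrough e ∈ L ∧
    ∀ z ∈ P, e.1.1 < z.1 → z.1 < e.2.1 → z.2 ≠ lineHeight (lineThrough e) z.1

/-- Two distinct segments cross if their relative interiors meet. -/
def Crosses (e f : (ℝ × ℝ) × (ℝ × ℝ)) : Prop :=
  e ≠ f ∧ ∃ x, e.1.1 < x ∧ x < e.2.1 ∧ f.1.1 < x ∧ x < f.2.1 ∧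
    lineHeight (lineThrough e) x = lineHeight (lineThrough f) x

open Classical in
/-- The points of `P` on the line `l`. -/
noncomputable def pointsOn (P : Finset (ℝ × ℝ)) (l : ℝ × ℝ) : Finset (ℝ × ℝ) :=
  P.filter fun p => p.2 = lineHeight l p.1

lemma mem_pointsOn {P : Finset (ℝ × ℝ)} {l p : ℝ × ℝ} :
    p ∈ pointsOn P l ↔ p ∈ P ∧ p.2 = lineHeight l p.1 := by
  simp [pointsOn]

lemma lineThrough_eq {l : ℝ × ℝ} {e : (ℝ × ℝ) × (ℝ × ℝ)} (h : e.1.1 < e.2.1)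
    (h1 : e.1.2 = lineHeight l e.1.1) (h2 : e.2.2 = lineHeight l e.2.1) : lineThrough e = l :=
  line_eq_of_lineHeight_eq h.ne ((lineHeight_lineThrough_fst e).trans h1)
    ((lineHeight_lineThrough_snd h).trans h2)

lemma mem_arrangementEdges {P L : Finset (ℝ × ℝ)} {e : (ℝ × ℝ) × (ℝ × ℝ)} :
    e ∈ arrangementEdges P L ↔ (e.1 ∈ P ∧ e.2 ∈ P) ∧ e.1.1 < e.2.1 ∧ lineThrough e ∈ L ∧
      ∀ z ∈ P, e.1.1 < z.1 → z.1 < e.2.1 → z.2 ≠ lineHeight (lineThrough e) z.1 := by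
  simp [arrangementEdges]

section Arrangement

variable {P L : Finset (ℝ × ℝ)}

lemma card_sub_one_le_card_edges (hP : Set.InjOn Prod.fst (P : Set (ℝ × ℝ))) {l : ℝ × ℝ}
    (hl : l ∈ L) [DecidableEq (ℝ × ℝ)] :
    (pointsOn P l).card - 1 ≤ ((arrangementEdges P L).filter fun e => lineThrough e = l).card := by
  rcases (pointsOn P l).eq_empty_or_nonempty with h0 | h0
  · simp [h0]
  obtain ⟨m, hm, hmax⟩ := Finset.exists_max_image _ Prod.fst h0
  rw [← Finset.card_erase_of_mem hm]
  refine (Finset.card_le_card ?_).trans (Finset.card_image_le (f := Prod.fst))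
  intro a ha
  obtain ⟨ham, ha⟩ := Finset.mem_erase.1 ha
  have hma : a.1 < m.1 := lt_of_le_of_ne (hmax a ha) fun h =>
    ham (hP (mem_pointsOn.1 ha).1 (mem_pointsOn.1 hm).1 h)
  obtain ⟨b, hb, hbmin⟩ := Finset.exists_min_image
    ((pointsOn P l).filter fun b => a.1 < b.1) Prod.fst ⟨m, by simp [hm, hma]⟩
  obtain ⟨hb, hab⟩ := Finset.mem_filter.1 hb
  have hline : lineThrough (a, b) = l :=
    lineThrough_eq hab (mem_pointsOn.1 ha).2 (mem_pointsOn.1 hb).2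
  refine Finset.mem_image.2 ⟨(a, b), Finset.mem_filter.2 ⟨mem_arrangementEdges.2
    ⟨⟨(mem_pointsOn.1 ha).1, (mem_pointsOn.1 hb).1⟩, hab, hline ▸ hl, ?_⟩, hline⟩, rfl⟩
  intro z hz h1 h2 h3
  rw [hline] at h3
  have := hbmin z (Finset.mem_filter.2 ⟨mem_pointsOn.2 ⟨hz, h3⟩, h1⟩)
  exact absurd h2 this.not_gt

lemma card_mul_le_card_edges (hP : Set.InjOn Prod.fst (P : Set (ℝ × ℝ))) {k : ℕ}
    (hk : ∀ l ∈ L, k ≤ (pointsOn P l).card) : L.card * (k - 1) ≤ (arrangementEdges P L).card := by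
  classical
  rw [Finset.card_eq_sum_card_fiberwise (f := lineThrough) (t := L)
    fun e he => (mem_arrangementEdges.1 he).2.2.1, ← smul_eq_mul]
  exact Finset.card_nsmul_le_sum _ _ _ fun l hl =>
    (Nat.sub_le_sub_right (hk l hl) 1).trans (card_sub_one_le_card_edges hP hl)

lemma edge_eq_of_lineThrough_eq (hP : Set.InjOn Prod.fst (P : Set (ℝ × ℝ)))
    {e f : (ℝ × ℝ) × (ℝ × ℝ)} (he : e ∈ arrangementEdges P L) (hf : f ∈ arrangementEdges P L)
    (hl : lineThrough e = lineThrough f) {x : ℝ} (h1 : e.1.1 < x) (h2 : x < e.2.1)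
    (h3 : f.1.1 < x) (h4 : x < f.2.1) : e = f := by
  obtain ⟨⟨he1, he2⟩, helt, -, heav⟩ := mem_arrangementEdges.1 he
  obtain ⟨⟨hf1, hf2⟩, hflt, -, hfav⟩ := mem_arrangementEdges.1 hf
  refine Prod.ext (hP he1 hf1 (le_antisymm ?_ ?_)) (hP he2 hf2 (le_antisymm ?_ ?_))
  · by_contra! hc
    exact hfav _ he1 hc (h1.trans h4) (by rw [← hl, lineHeight_lineThrough_fst])
  · by_contra! hc
    exact heav _ hf1 hc (h3.trans h2) (by rw [hl, lineHeight_lineThrough_fst])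
  · by_contra! hc
    exact heav _ hf2 (h1.trans h4) hc (by rw [hl, lineHeight_lineThrough_snd hflt])
  · by_contra! hc
    exact hfav _ he2 (h3.trans h2) hc (by rw [← hl, lineHeight_lineThrough_snd helt])

lemma Crosses.lineThrough_ne (hP : Set.InjOn Prod.fst (P : Set (ℝ × ℝ)))
    {e f : (ℝ × ℝ) × (ℝ × ℝ)} (he : e ∈ arrangementEdges P L) (hf : f ∈ arrangementEdges P L)
    (h : Crosses e f) : lineThrough e ≠ lineThrough f := by
  obtain ⟨hne, x, h1, h2, h3, h4, -⟩ := h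
  exact fun hl => hne (edge_eq_of_lineThrough_eq hP he hf hl h1 h2 h3 h4)

open Classical in
/-- Ordered pairs of crossing edges of the arrangement. -/
noncomputable def crossings (P L : Finset (ℝ × ℝ)) :
    Finset (((ℝ × ℝ) × (ℝ × ℝ)) × ((ℝ × ℝ) × (ℝ × ℝ))) :=
  (arrangementEdges P L ×ˢ arrangementEdges P L).filter fun c => Crosses c.1 c.2

lemma mem_crossings {c : ((ℝ × ℝ) × (ℝ × ℝ)) × ((ℝ × ℝ) × (ℝ × ℝ))} :
    c ∈ crossings P L ↔
      (c.1 ∈ arrangementEdges P L ∧ c.2 ∈ arrangementEdges P L) ∧ Crosses c.1 c.2 := by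
  simp [crossings]

lemma card_crossings_le (hP : Set.InjOn Prod.fst (P : Set (ℝ × ℝ))) :
    (crossings P L).card ≤ L.card ^ 2 := by
  rw [sq, ← Finset.card_product]
  refine Finset.card_le_card_of_injOn (fun c => (lineThrough c.1, lineThrough c.2)) ?_ ?_
  · intro c hc
    obtain ⟨⟨h1, h2⟩, -⟩ := mem_crossings.1 hc
    exact Finset.mem_product.2 ⟨(mem_arrangementEdges.1 h1).2.2.1, (mem_arrangementEdges.1 h2).2.2.1⟩
  · intro c hc d hd heq
    obtain ⟨⟨hc1, hc2⟩, hcc⟩ := mem_crossings.1 hc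
    obtain ⟨⟨hd1, hd2⟩, hdd⟩ := mem_crossings.1 hd
    simp only [Prod.mk.injEq] at heq
    obtain ⟨-, x, x1, x2, x3, x4, hx⟩ := id hcc
    obtain ⟨-, y, y1, y2, y3, y4, hy⟩ := id hdd
    rw [← heq.1, ← heq.2] at hy
    obtain rfl : x = y := by
      by_contra hxy
      exact hcc.lineThrough_ne hP hc1 hc2 (line_eq_of_lineHeight_eq hxy hx hy)
    exact Prod.ext (edge_eq_of_lineThrough_eq hP hc1 hd1 heq.1 x1 x2 y1 y2)
      (edge_eq_of_lineThrough_eq hP hc2 hd2 heq.2 x3 x4 y3 y4)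

lemma card_endpoints_of_mem_crossings (hP : Set.InjOn Prod.fst (P : Set (ℝ × ℝ)))
    {c : ((ℝ × ℝ) × (ℝ × ℝ)) × ((ℝ × ℝ) × (ℝ × ℝ))} (hc : c ∈ crossings P L)
    [DecidableEq (ℝ × ℝ)] : ({c.1.1, c.1.2, c.2.1, c.2.2} : Finset (ℝ × ℝ)).card = 4 := by
  obtain ⟨⟨h1, h2⟩, hcr⟩ := mem_crossings.1 hc
  have hl := hcr.lineThrough_ne hP h1 h2
  obtain ⟨-, x, x1, x2, x3, x4, hx⟩ := hcr
  have l1 := (mem_arrangementEdges.1 h1).2.1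
  have l2 := (mem_arrangementEdges.1 h2).2.1
  have key : ∀ p : ℝ × ℝ, p.1 ≠ x → p.2 = lineHeight (lineThrough c.1) p.1 →
      p.2 = lineHeight (lineThrough c.2) p.1 → False := fun p hp k1 k2 =>
    hl (line_eq_of_lineHeight_eq hp (k1.symm.trans k2) hx)
  have a1 := (lineHeight_lineThrough_fst c.1).symm
  have a2 := (lineHeight_lineThrough_snd l1).symm
  have b1 := (lineHeight_lineThrough_fst c.2).symm
  have b2 := (lineHeight_lineThrough_snd l2).symm
  have n1 : c.1.1 ≠ c.1.2 := fun h => l1.ne (by rw [h])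
  have n2 : c.1.1 ≠ c.2.1 := fun h => key _ x1.ne a1 (h ▸ b1)
  have n3 : c.1.1 ≠ c.2.2 := fun h => key _ x1.ne a1 (h ▸ b2)
  have n4 : c.1.2 ≠ c.2.1 := fun h => key _ x2.ne' a2 (h ▸ b1)
  have n5 : c.1.2 ≠ c.2.2 := fun h => key _ x2.ne' a2 (h ▸ b2)
  have n6 : c.2.1 ≠ c.2.2 := fun h => l2.ne (by rw [h])
  rw [Finset.card_insert_of_notMem (by simp [n1, n2, n3]),
    Finset.card_insert_of_notMem (by simp [n4, n5]), Finset.card_pair n6]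

lemma card_edges_le_add_crossings (hP : Set.InjOn Prod.fst (P : Set (ℝ × ℝ)))
    {S : Finset (ℝ × ℝ)} (hS : S ⊆ P) [DecidableEq (ℝ × ℝ)] :
    ((arrangementEdges P L).filter fun e => {e.1, e.2} ⊆ S).card ≤ 3 * S.card +
      ((crossings P L).filter fun c => {c.1.1, c.1.2, c.2.1, c.2.2} ⊆ S).card := by
  classical
  set A := (arrangementEdges P L).filter fun e => {e.1, e.2} ⊆ S with hA
  set X := (crossings P L).filter fun c => {c.1.1, c.1.2, c.2.1, c.2.2} ⊆ S with hX
  have hdraw : IsPlaneDrawing S (A \ X.image Prod.fst) := by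
    have hmem : ∀ e ∈ A \ X.image Prod.fst,
        e ∈ arrangementEdges P L ∧ e.1 ∈ S ∧ e.2 ∈ S := fun e he => by
      have := Finset.mem_filter.1 (Finset.mem_sdiff.1 he).1
      simpa [Finset.insert_subset_iff] using this
    refine ⟨hP.mono (by exact_mod_cast hS), fun e he => (hmem e he).2.1,
      fun e he => (hmem e he).2.2, fun e he => (mem_arrangementEdges.1 (hmem e he).1).2.1,
      fun e he z hz => (mem_arrangementEdges.1 (hmem e he).1).2.2.2 z (hS hz), ?_⟩
    intro e he f hf x h1 h2 h3 h4 h5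
    by_contra hne
    refine (Finset.mem_sdiff.1 he).2 (Finset.mem_image.2 ⟨(e, f), Finset.mem_filter.2
      ⟨mem_crossings.2 ⟨⟨(hmem e he).1, (hmem f hf).1⟩, hne, x, h1, h2, h3, h4, h5⟩, ?_⟩, rfl⟩)
    simpa [Finset.insert_subset_iff] using
      ⟨(hmem e he).2.1, (hmem e he).2.2, (hmem f hf).2⟩
  have h1 := hdraw.card_le
  have h2 := Finset.le_card_sdiff (X.image Prod.fst) A
  have h3 : (X.image Prod.fst).card ≤ X.card := Finset.card_image_le
  omega

end Arrangement

section Sampling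

variable {α ι : Type*} [DecidableEq α]

lemma sum_weight_of_subset {P T : Finset α} (hT : T ⊆ P) (p : ℝ) :
    ∑ S ∈ P.powerset with T ⊆ S, p ^ S.card * (1 - p) ^ (P.card - S.card) = p ^ T.card := by
  have h := Finset.sum_pow_mul_eq_add_pow p (1 - p) (P \ T)
  rw [add_sub_cancel, one_pow] at h
  refine Eq.trans ?_ (mul_one _)
  refine Eq.trans ?_ (congrArg (p ^ T.card * ·) h)
  simp only [Finset.mul_sum]
  refine Finset.sum_nbij' (· \ T) (· ∪ T) ?_ ?_ ?_ ?_ ?_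
  · intro S hS
    simp only [Finset.mem_filter, Finset.mem_powerset] at hS ⊢
    exact Finset.sdiff_subset_sdiff hS.1 le_rfl
  · intro R hR
    simp only [Finset.mem_filter, Finset.mem_powerset] at hR ⊢
    exact ⟨Finset.union_subset (hR.trans Finset.sdiff_subset) hT, Finset.subset_union_right⟩
  · intro S hS
    simp only [Finset.mem_filter] at hS
    exact Finset.sdiff_union_of_subset hS.2
  · intro R hR
    rw [Finset.mem_powerset] at hR
    exact Finset.union_sdiff_cancel_right
      (Finset.disjoint_of_subset_left hR Finset.sdiff_disjoint)
  · intro S hS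
    simp only [Finset.mem_filter, Finset.mem_powerset] at hS
    have h1 := Finset.card_sdiff_add_card_eq_card hS.2
    have h2 := Finset.card_sdiff_add_card_eq_card hT
    have h3 := Finset.card_le_card hS.1
    rw [← mul_assoc, ← pow_add, add_comm, h1,
      show (P \ T).card - (S \ T).card = P.card - S.card by omega]

/-- The expected number of members of a family of `j`-sets contained in a `p`-random subset. -/
lemma sum_weight_mul_card {P : Finset α} (I : Finset ι) (t : ι → Finset α) {j : ℕ}
    (ht : ∀ i ∈ I, t i ⊆ P ∧ (t i).card = j) (p : ℝ) :
    ∑ S ∈ P.powerset, p ^ S.card * (1 - p) ^ (P.card - S.card) *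
      ((I.filter fun i => t i ⊆ S).card : ℝ) = I.card * p ^ j := by
  simp only [Finset.card_filter, Nat.cast_sum, Finset.mul_sum]
  rw [Finset.sum_comm, ← nsmul_eq_mul]
  refine (Finset.sum_congr rfl fun i hi => ?_).trans (Finset.sum_const _)
  rw [← (ht i hi).2, ← sum_weight_of_subset (ht i hi).1 p, Finset.sum_filter]
  exact Finset.sum_congr rfl fun S _ => by split_ifs <;> simp

lemma sum_weight_mul_card_self (P : Finset α) (p : ℝ) :
    ∑ S ∈ P.powerset, p ^ S.card * (1 - p) ^ (P.card - S.card) * (S.card : ℝ) = P.card * p := by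
  have h := sum_weight_mul_card (P := P) P (fun a => {a}) (j := 1) (by simp) p
  rw [pow_one] at h
  rw [← h]
  refine Finset.sum_congr rfl fun S hS => ?_
  simp only [Finset.singleton_subset_iff, Finset.filter_mem_eq_inter,
    Finset.inter_eq_right.2 (Finset.mem_powerset.1 hS)]

end Sampling

lemma crossing_inequality {P L : Finset (ℝ × ℝ)} (hP : Set.InjOn Prod.fst (P : Set (ℝ × ℝ)))
    {p : ℝ} (h0 : 0 ≤ p) (h1 : p ≤ 1) :
    (arrangementEdges P L).card * p ^ 2 ≤ 3 * (P.card * p) + (L.card : ℝ) ^ 2 * p ^ 4 := by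
  classical
  have hE := sum_weight_mul_card (P := P) (arrangementEdges P L)
    (fun e => ({e.1, e.2} : Finset (ℝ × ℝ))) (j := 2) (fun e he => by
      obtain ⟨⟨h1, h2⟩, hlt, -⟩ := mem_arrangementEdges.1 he
      exact ⟨by simp [Finset.insert_subset_iff, h1, h2],
        Finset.card_pair fun h => hlt.ne (by rw [h])⟩) p
  have hX := sum_weight_mul_card (P := P) (crossings P L)
    (fun c => ({c.1.1, c.1.2, c.2.1, c.2.2} : Finset (ℝ × ℝ))) (j := 4) (fun c hc => by
      obtain ⟨⟨h1, h2⟩, -⟩ := mem_crossings.1 hc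
      have h1 := (mem_arrangementEdges.1 h1).1
      have h2 := (mem_arrangementEdges.1 h2).1
      exact ⟨by simp [Finset.insert_subset_iff, h1, h2], card_endpoints_of_mem_crossings hP hc⟩) p
  have hX' : ((crossings P L).card : ℝ) ≤ (L.card : ℝ) ^ 2 := by
    exact_mod_cast card_crossings_le hP
  refine le_trans ?_ (add_le_add_right (mul_le_mul_of_nonneg_right hX' (pow_nonneg h0 4)) _)
  rw [← hE, ← hX, ← sum_weight_mul_card_self, Finset.mul_sum, ← Finset.sum_add_distrib]
  refine Finset.sum_le_sum fun S hS => ?_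
  have h := card_edges_le_add_crossings (L := L) hP (Finset.mem_powerset.1 hS)
  have h' : (((arrangementEdges P L).filter fun e => {e.1, e.2} ⊆ S).card : ℝ) ≤ 3 * S.card +
      ((crossings P L).filter fun c => {c.1.1, c.1.2, c.2.1, c.2.2} ⊆ S).card := by
    exact_mod_cast h
  have hw : 0 ≤ p ^ S.card * (1 - p) ^ (P.card - S.card) :=
    mul_nonneg (pow_nonneg h0 _) (pow_nonneg (sub_nonneg.2 h1) _)
  calc _ ≤ _ := mul_le_mul_of_nonneg_left h' hw
    _ = _ := by ring

/-- The Szemerédi–Trotter bound on the number of `k`-rich lines. -/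
theorem card_rich_lines_le {P L : Finset (ℝ × ℝ)} (hP : Set.InjOn Prod.fst (P : Set (ℝ × ℝ)))
    {k : ℕ} (hk2 : 2 ≤ k) (hk : ∀ l ∈ L, k ≤ (pointsOn P l).card) :
    (L.card : ℝ) ≤ 576 * (P.card : ℝ) ^ 2 / (k : ℝ) ^ 3 + 12 * P.card / k := by
  have hkpos : (0 : ℝ) < k := by positivity
  have hn : (0 : ℝ) ≤ P.card := Nat.cast_nonneg _
  rcases L.card.eq_zero_or_pos with hL0 | hL0
  · rw [hL0]; push_cast; positivity
  have hL : (0 : ℝ) < L.card := by exact_mod_cast hL0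
  have hE : (L.card : ℝ) * (k / 2) ≤ (arrangementEdges P L).card := by
    have h1 : ((L.card * (k - 1) : ℕ) : ℝ) ≤ (arrangementEdges P L).card := by
      exact_mod_cast card_mul_le_card_edges hP hk
    rw [Nat.cast_mul, Nat.cast_sub (by omega)] at h1
    refine le_trans (mul_le_mul_of_nonneg_left ?_ hL.le) h1
    have : (2 : ℝ) ≤ k := by exact_mod_cast hk2
    push_cast; linarith
  have hcr : ∀ p : ℝ, 0 < p → p ≤ 1 →
      (L.card : ℝ) * k / 2 * p ≤ 3 * P.card + (L.card : ℝ) ^ 2 * p ^ 3 := by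
    intro p h0 h1
    have h := crossing_inequality (L := L) hP h0.le h1
    have h2 := mul_le_mul_of_nonneg_right hE (sq_nonneg p)
    refine le_of_mul_le_mul_right ?_ h0
    linarith
  have t1 : 0 ≤ 576 * (P.card : ℝ) ^ 2 / (k : ℝ) ^ 3 := by positivity
  have t2 : 0 ≤ 12 * (P.card : ℝ) / k := by positivity
  rcases le_or_gt (k : ℝ) (4 * L.card) with hc | hc
  · have hp2 : √((k : ℝ) / (4 * L.card)) ^ 2 = (k : ℝ) / (4 * L.card) :=
      Real.sq_sqrt (by positivity)
    have hp0 : 0 < √((k : ℝ) / (4 * L.card)) := Real.sqrt_pos.2 (by positivity)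
    have hp1 : √((k : ℝ) / (4 * L.card)) ≤ 1 :=
      Real.sqrt_le_one.2 ((div_le_one (by positivity)).2 hc)
    set p := √((k : ℝ) / (4 * L.card))
    have h := hcr p hp0 hp1
    have h3 : (L.card : ℝ) ^ 2 * p ^ 3 = (L.card : ℝ) * k / 4 * p := by
      rw [pow_succ p 2, hp2]; field_simp
    rw [h3] at h
    have h4 : (L.card : ℝ) * k * p ≤ 12 * P.card := by linarith
    have h5 : ((L.card : ℝ) * k * p) ^ 2 ≤ (12 * P.card) ^ 2 :=
      pow_le_pow_left₀ (by positivity) h4 2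
    have h6 : ((L.card : ℝ) * k * p) ^ 2 = L.card * (k : ℝ) ^ 3 / 4 := by
      rw [mul_pow, hp2]; field_simp
    refine le_trans ?_ (le_add_of_nonneg_right t2)
    rw [le_div_iff₀ (by positivity)]
    linarith
  · have h := hcr 1 one_pos le_rfl
    refine le_trans ?_ (le_add_of_nonneg_left t1)
    rw [le_div_iff₀ hkpos]
    have := mul_le_mul_of_nonneg_left hc.le hL.le
    linarith

lemma collinear_pointsOn (P : Finset (ℝ × ℝ)) (l : ℝ × ℝ) :
    Collinear ℝ (pointsOn P l : Set (ℝ × ℝ)) := by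
  rw [collinear_iff_exists_forall_eq_smul_vadd]
  refine ⟨(0, l.2), (1, l.1), fun p hp => ⟨p.1, ?_⟩⟩
  have := (mem_pointsOn.1 hp).2
  ext <;> simp [this, lineHeight]
  ring

lemma subset_pointsOn_of_collinear {P T : Finset (ℝ × ℝ)} (hT : T ⊆ P)
    (hcol : Collinear ℝ (T : Set (ℝ × ℝ))) {a b : ℝ × ℝ} (ha : a ∈ T) (hb : b ∈ T)
    (hab : a.1 < b.1) : T ⊆ pointsOn P (lineThrough (a, b)) := by
  obtain ⟨v, hv⟩ := (collinear_iff_of_mem (k := ℝ) (p₀ := a) (by exact_mod_cast ha)).1 hcol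
  intro p hp
  refine mem_pointsOn.2 ⟨hT hp, ?_⟩
  obtain ⟨r, hr⟩ := hv b hb
  obtain ⟨s, hs⟩ := hv p hp
  have r1 : b.1 - a.1 = r * v.1 := by rw [hr]; simp
  have r2 : b.2 - a.2 = r * v.2 := by rw [hr]; simp
  have s1 : p.1 - a.1 = s * v.1 := by rw [hs]; simp
  have s2 : p.2 - a.2 = s * v.2 := by rw [hs]; simp
  have hne : b.1 - a.1 ≠ 0 := by linarith
  have key : (b.2 - a.2) * (p.1 - a.1) = (p.2 - a.2) * (b.1 - a.1) := by
    rw [r1, r2, s1, s2]; ring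
  have : p.2 - a.2 = (b.2 - a.2) / (b.1 - a.1) * (p.1 - a.1) := by
    rw [div_mul_eq_mul_div, key, mul_div_cancel_right₀ _ hne]
  simp only [lineHeight, lineThrough]
  linarith

open Classical in
/-- The lines spanned by pairs of points of `P`. -/
noncomputable def spannedLines (P : Finset (ℝ × ℝ)) : Finset (ℝ × ℝ) :=
  ((P ×ˢ P).filter fun e => e.1.1 < e.2.1).image lineThrough

open Classical in
/-- The collinear triples of points of `P`. -/
noncomputable def collinearTriples (P : Finset (ℝ × ℝ)) : Finset (Finset (ℝ × ℝ)) :=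
  (P.powersetCard 3).filter fun T => Collinear ℝ (T : Set (ℝ × ℝ))

lemma mem_collinearTriples {P T : Finset (ℝ × ℝ)} :
    T ∈ collinearTriples P ↔ (T ⊆ P ∧ T.card = 3) ∧ Collinear ℝ (T : Set (ℝ × ℝ)) := by
  simp [collinearTriples, Finset.mem_powersetCard]

lemma card_collinearTriples_le {P : Finset (ℝ × ℝ)}
    (hP : Set.InjOn Prod.fst (P : Set (ℝ × ℝ))) :
    (collinearTriples P).card ≤ ∑ l ∈ spannedLines P, (pointsOn P l).card.choose 3 := by
  classical
  have hsub : collinearTriples P ⊆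
      (spannedLines P).biUnion fun l => (pointsOn P l).powersetCard 3 := by
    intro T hT
    obtain ⟨⟨hTP, hcard⟩, hcol⟩ := mem_collinearTriples.1 hT
    obtain ⟨a, ha, b, hb, hab⟩ := Finset.one_lt_card.1 (by omega : 1 < T.card)
    obtain ⟨a, ha, b, hb, hab⟩ : ∃ a ∈ T, ∃ b ∈ T, a.1 < b.1 := by
      rcases lt_trichotomy a.1 b.1 with h | h | h
      · exact ⟨a, ha, b, hb, h⟩
      · exact absurd (hP (hTP ha) (hTP hb) h) hab
      · exact ⟨b, hb, a, ha, h⟩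
    refine Finset.mem_biUnion.2 ⟨lineThrough (a, b), Finset.mem_image.2
      ⟨(a, b), by simp [hTP ha, hTP hb, hab], rfl⟩, Finset.mem_powersetCard.2
      ⟨subset_pointsOn_of_collinear hTP hcol ha hb hab, hcard⟩⟩
  refine (Finset.card_le_card hsub).trans (Finset.card_biUnion_le.trans ?_)
  simp [Finset.card_powersetCard]

lemma sum_range_choose_two (k : ℕ) : ∑ j ∈ Finset.range k, j.choose 2 = k.choose 3 := by
  induction k with
  | zero => simp
  | succ k ih => rw [Finset.sum_range_succ, ih, Nat.choose_succ_succ' k 2, add_comm]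

lemma sum_choose_three_eq {α : Type*} (s : Finset α) (f : α → ℕ) {q : ℕ}
    (hf : ∀ a ∈ s, f a ≤ q) : ∑ a ∈ s, (f a).choose 3 =
      ∑ j ∈ Finset.range q, (s.filter fun a => j + 1 ≤ f a).card * j.choose 2 := by
  simp only [Finset.card_filter, Finset.sum_mul, ite_mul, one_mul, zero_mul]
  rw [Finset.sum_comm]
  refine Finset.sum_congr rfl fun a ha => ?_
  rw [← sum_range_choose_two, ← Finset.sum_filter]
  refine Finset.sum_congr (Finset.ext fun j => ?_) fun _ _ => rfl
  have := hf a ha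
  simp only [Finset.mem_range, Finset.mem_filter]
  omega

/-- The number of collinear triples of a point set with at most `q` points on a line. -/
lemma card_collinearTriples_le_log {P : Finset (ℝ × ℝ)}
    (hP : Set.InjOn Prod.fst (P : Set (ℝ × ℝ))) {q : ℕ}
    (hq : ∀ l, (pointsOn P l).card ≤ q) :
    ((collinearTriples P).card : ℝ) ≤
      288 * (P.card : ℝ) ^ 2 * (1 + Real.log q) + 6 * P.card * (q : ℝ) ^ 2 := by
  classical
  have h1 := card_collinearTriples_le hP
  rw [sum_choose_three_eq _ _ fun l _ => hq l] at h1
  have h1' : ((collinearTriples P).card : ℝ) ≤ ∑ j ∈ Finset.range q,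
      ((((spannedLines P).filter fun l => j + 1 ≤ (pointsOn P l).card).card : ℝ) *
        (j.choose 2 : ℕ)) := by
    exact_mod_cast h1
  refine h1'.trans ?_
  have hterm : ∀ j ∈ Finset.range q,
      ((((spannedLines P).filter fun l => j + 1 ≤ (pointsOn P l).card).card : ℝ) *
        (j.choose 2 : ℕ)) ≤
      288 * (P.card : ℝ) ^ 2 * ((j + 1 : ℕ) : ℝ)⁻¹ + 6 * P.card * q := by
    intro j hj
    rcases Nat.eq_zero_or_pos j with rfl | hj0
    · simp; positivity
    have hst := card_rich_lines_le (L := (spannedLines P).filter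
      fun l => j + 1 ≤ (pointsOn P l).card) hP (k := j + 1) (by omega)
      fun l hl => (Finset.mem_filter.1 hl).2
    have hch : ((j.choose 2 : ℕ) : ℝ) ≤ ((j + 1 : ℕ) : ℝ) ^ 2 / 2 := by
      rw [Nat.cast_choose_two]
      push_cast
      have : (0 : ℝ) ≤ j := Nat.cast_nonneg _
      nlinarith
    have hjq : ((j + 1 : ℕ) : ℝ) ≤ q := by exact_mod_cast Finset.mem_range.1 hj
    have hjpos : (0 : ℝ) < ((j + 1 : ℕ) : ℝ) := by positivity
    generalize ((j + 1 : ℕ) : ℝ) = x at *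
    calc _ ≤ (576 * (P.card : ℝ) ^ 2 / x ^ 3 + 12 * P.card / x) * (x ^ 2 / 2) :=
          mul_le_mul hst hch (Nat.cast_nonneg _) (by positivity)
      _ = 288 * (P.card : ℝ) ^ 2 * x⁻¹ + 6 * P.card * x := by field_simp; ring
      _ ≤ _ := by gcongr
  refine (Finset.sum_le_sum hterm).trans ?_
  rw [Finset.sum_add_distrib, ← Finset.mul_sum, Finset.sum_const, Finset.card_range, nsmul_eq_mul]
  have hh := harmonic_le_one_add_log q
  rw [harmonic] at hh
  push_cast at hh ⊢
  have := mul_le_mul_of_nonneg_left hh (by positivity : 0 ≤ 288 * (P.card : ℝ) ^ 2)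
  linarith

lemma exists_generalPosition {P S : Finset (ℝ × ℝ)} (hS : S ⊆ P) [DecidableEq (ℝ × ℝ)] :
    ∃ S' ⊆ S, GeneralPosition S' ∧
      S.card ≤ S'.card + ((collinearTriples P).filter fun T => T ⊆ S).card := by
  classical
  have hpt : ∀ T ∈ collinearTriples P, ∃ a, a ∈ T := fun T hT =>
    Finset.card_pos.1 (by rw [(mem_collinearTriples.1 hT).1.2]; norm_num)
  choose! a ha using hpt
  refine ⟨S \ ((collinearTriples P).filter fun T => T ⊆ S).image a, Finset.sdiff_subset, ?_, ?_⟩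
  · intro T hT hcol
    by_contra! hc
    obtain ⟨T', hT', hcard⟩ := Finset.exists_subset_card_eq (show 3 ≤ T.card from hc)
    have hTS : T' ⊆ S := hT'.trans (hT.trans Finset.sdiff_subset)
    have hmem : T' ∈ collinearTriples P :=
      mem_collinearTriples.2 ⟨⟨hTS.trans hS, hcard⟩, hcol.subset (by exact_mod_cast hT')⟩
    exact (Finset.mem_sdiff.1 (hT (hT' (ha T' hmem)))).2
      (Finset.mem_image_of_mem a (Finset.mem_filter.2 ⟨hmem, hTS⟩))
  · have h1 := Finset.le_card_sdiff
      (((collinearTriples P).filter fun T => T ⊆ S).image a) S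
    have h2 : (((collinearTriples P).filter fun T => T ⊆ S).image a).card ≤ _ :=
      Finset.card_image_le
    omega

lemma GeneralPosition.mono {S T : Finset (ℝ × ℝ)} (hT : GeneralPosition T) (h : S ⊆ T) :
    GeneralPosition S := fun U hU => hT U (hU.trans h)

lemma card_mul_le_of_no_generalPosition {P : Finset (ℝ × ℝ)} {q : ℕ}
    (hq : ∀ S ⊆ P, S.card = q → ¬ GeneralPosition S) {p : ℝ} (h0 : 0 ≤ p) (h1 : p ≤ 1) :
    P.card * p ≤ q + (collinearTriples P).card * p ^ 3 := by
  classical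
  have hT := sum_weight_mul_card (P := P) (collinearTriples P) id (j := 3)
    (fun T hT => (mem_collinearTriples.1 hT).1) p
  have hone := Finset.sum_pow_mul_eq_add_pow p (1 - p) P
  rw [add_sub_cancel, one_pow] at hone
  have hqsum := (Finset.sum_mul _ _ (q : ℝ)).symm.trans (congrArg (· * (q : ℝ)) hone)
  rw [one_mul] at hqsum
  refine le_trans ?_ (congrArg₂ (· + ·) hqsum hT).le
  rw [← sum_weight_mul_card_self, ← Finset.sum_add_distrib]
  refine Finset.sum_le_sum fun S hS => ?_
  rw [← mul_add]
  refine mul_le_mul_of_nonneg_left ?_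
    (mul_nonneg (pow_nonneg h0 _) (pow_nonneg (sub_nonneg.2 h1) _))
  obtain ⟨S', hS', hgp, hcard⟩ := exists_generalPosition (Finset.mem_powerset.1 hS)
  have hlt : S'.card < q := by
    by_contra! hc
    obtain ⟨U, hU, hUq⟩ := Finset.exists_subset_card_eq hc
    exact hq U (hU.trans (hS'.trans (Finset.mem_powerset.1 hS))) hUq (hgp.mono hU)
  simp only [id]
  exact_mod_cast hcard.trans (Nat.add_le_add_right hlt.le _)

lemma exists_collinear_or_generalPosition_of_injOn {q : ℕ} (hq : 3 ≤ q) {P : Finset (ℝ × ℝ)}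
    (hP : Set.InjOn Prod.fst (P : Set (ℝ × ℝ)))
    (hcard : 5000 * (q : ℝ) ^ 2 * Real.log q ≤ P.card) :
    (∃ S ⊆ P, S.card = q ∧ Collinear ℝ (S : Set (ℝ × ℝ))) ∨
      (∃ S ⊆ P, S.card = q ∧ GeneralPosition S) := by
  by_contra! hcon
  obtain ⟨hcol, hgp⟩ := hcon
  have hline : ∀ l, (pointsOn P l).card ≤ q := by
    intro l
    by_contra! hc
    obtain ⟨U, hU, hUq⟩ := Finset.exists_subset_card_eq hc.le
    exact hcol U (hU.trans (Finset.filter_subset _ _)) hUq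
      ((collinear_pointsOn P l).subset (by exact_mod_cast hU))
  have hq3 : (3 : ℝ) ≤ q := by exact_mod_cast hq
  have hlog : 1 ≤ Real.log q := by
    rw [Real.le_log_iff_exp_le (by linarith)]
    linarith [Real.exp_one_lt_d9]
  have hm := card_collinearTriples_le_log hP hline
  set n := (P.card : ℝ)
  set m := ((collinearTriples P).card : ℝ)
  set y := Real.log q
  have hqn : (q : ℝ) ^ 2 ≤ n := by nlinarith [sq_nonneg (q : ℝ)]
  have hn : 9 ≤ n := by nlinarith
  have hm' : m ≤ 582 * n ^ 2 * y := by nlinarith [sq_nonneg n]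
  have hp2 : √(1 / (1164 * n * y)) ^ 2 = 1 / (1164 * n * y) := Real.sq_sqrt (by positivity)
  have hp0 : 0 < √(1 / (1164 * n * y)) := Real.sqrt_pos.2 (by positivity)
  have hp1 : √(1 / (1164 * n * y)) ≤ 1 :=
    Real.sqrt_le_one.2 ((div_le_one (by positivity)).2 (by nlinarith))
  have h := card_mul_le_of_no_generalPosition hgp hp0.le hp1
  set p := √(1 / (1164 * n * y))
  have h3 : m * p ^ 3 ≤ n * p / 2 := by
    calc m * p ^ 3 ≤ 582 * n ^ 2 * y * p ^ 3 := by gcongr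
      _ = n * p / 2 := by rw [pow_succ p 2, hp2]; field_simp; norm_num
  have h4 : n * p ≤ 2 * q := by
    have : n * p ≤ q + m * p ^ 3 := h
    linarith
  have h5 : (n * p) ^ 2 ≤ (2 * q) ^ 2 := pow_le_pow_left₀ (by positivity) h4 2
  have h6 : (n * p) ^ 2 = n / (1164 * y) := by rw [mul_pow, hp2]; field_simp
  rw [h6, div_le_iff₀ (by positivity)] at h5
  have h7 : 0 < (q : ℝ) ^ 2 * y := by positivity
  nlinarith

lemma exists_shear_injOn (P : Finset (ℝ × ℝ)) :
    ∃ t : ℝ, Set.InjOn (fun p : ℝ × ℝ => p.1 + t * p.2) (P : Set (ℝ × ℝ)) := by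
  classical
  obtain ⟨t, ht⟩ := Infinite.exists_notMem_finset
    ((P ×ˢ P).image fun e => (e.1.1 - e.2.1) / (e.2.2 - e.1.2))
  refine ⟨t, fun a ha b hb hab => ?_⟩
  simp only at hab
  by_cases h2 : a.2 = b.2
  · refine Prod.ext ?_ h2
    rw [h2] at hab; linarith
  · refine absurd (Finset.mem_image.2 ⟨(a, b), by simpa using ⟨ha, hb⟩, ?_⟩) ht
    rw [div_eq_iff (sub_ne_zero.2 (Ne.symm h2))]
    linarith

/-- The linear equivalence `(x, y) ↦ (x + t y, y)`. -/
def shear (t : ℝ) : (ℝ × ℝ) ≃ₗ[ℝ] (ℝ × ℝ) where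
  toFun p := (p.1 + t * p.2, p.2)
  invFun p := (p.1 - t * p.2, p.2)
  map_add' p r := by ext <;> simp; ring
  map_smul' c p := by ext <;> simp; ring
  left_inv p := by ext <;> simp
  right_inv p := by ext <;> simp

lemma Collinear.image_linearEquiv {s : Set (ℝ × ℝ)} (h : Collinear ℝ s)
    (φ : (ℝ × ℝ) ≃ₗ[ℝ] (ℝ × ℝ)) : Collinear ℝ (φ '' s) := by
  rw [collinear_iff_exists_forall_eq_smul_vadd] at h ⊢
  obtain ⟨p₀, v, hv⟩ := h
  refine ⟨φ p₀, φ v, ?_⟩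
  rintro _ ⟨p, hp, rfl⟩
  obtain ⟨r, rfl⟩ := hv p hp
  exact ⟨r, by simp⟩

/-- There is `c > 0` such that for every `q ≥ 3`, every finite set of at least
`c·q²·log q` points in the plane contains `q` collinear points or `q` points in
general position (i.e. `GP(q) ≤ O(q² ln q)`). -/
theorem GP_upper_bound :
    ∃ c : ℝ, 0 < c ∧
      ∀ q : ℕ, 3 ≤ q →
        ∀ P : Finset (ℝ × ℝ),
          c * (q : ℝ) ^ 2 * Real.log q ≤ P.card →
          (∃ S ⊆ P, S.card = q ∧ Collinear ℝ (S : Set (ℝ × ℝ))) ∨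
          (∃ S ⊆ P, S.card = q ∧ GeneralPosition S) := by
  classical
  refine ⟨5000, by norm_num, fun q hq P hcard => ?_⟩
  obtain ⟨t, ht⟩ := exists_shear_injOn P
  let φ := shear t
  have hinj : Set.InjOn Prod.fst ((P.image φ : Finset (ℝ × ℝ)) : Set (ℝ × ℝ)) := by
    intro x hx y hy hxy
    simp only [Finset.coe_image] at hx hy
    obtain ⟨a, ha, rfl⟩ := hx
    obtain ⟨b, hb, rfl⟩ := hy
    rw [ht ha hb hxy]
  rw [← Finset.card_image_of_injective P φ.injective] at hcard
  have hback : ∀ S ⊆ P.image φ, S.image φ.symm ⊆ P := by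
    intro S hS x hx
    obtain ⟨y, hy, rfl⟩ := Finset.mem_image.1 hx
    obtain ⟨z, hz, rfl⟩ := Finset.mem_image.1 (hS hy)
    simpa using hz
  rcases exists_collinear_or_generalPosition_of_injOn hq hinj hcard with
    ⟨S, hS, hSq, hcol⟩ | ⟨S, hS, hSq, hgp⟩
  · refine Or.inl ⟨S.image φ.symm, hback S hS,
      by rw [Finset.card_image_of_injective _ φ.symm.injective, hSq], ?_⟩
    rw [Finset.coe_image]
    exact hcol.image_linearEquiv φ.symm
  · refine Or.inr ⟨S.image φ.symm, hback S hS,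
      by rw [Finset.card_image_of_injective _ φ.symm.injective, hSq], fun T hT hcol => ?_⟩
    rw [← Finset.card_image_of_injective T φ.injective]
    refine hgp _ (fun x hx => ?_) (by rw [Finset.coe_image]; exact hcol.image_linearEquiv φ)
    obtain ⟨y, hy, rfl⟩ := Finset.mem_image.1 hx
    obtain ⟨z, hz, rfl⟩ := Finset.mem_image.1 (hT hy)
    simpa using hz
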